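/- arXiv:1602.08328 — 2 statements merged into one kernel-verified Lean document; each statement's English description precedes it below -/
import Mathlib

section
/- The number of commutation classes of reduced expressions of the longest element of S_4 is exactly 8; that is, the quotient of the set of reduced expressions for the permutation [4,3,2,1] by commutation equivalence has cardinality 8. -/
/-- The adjacent transposition `sᵢ = (i, i+1)` (1-indexed) acting on `Fin n`
(0-indexed positions `i-1` and `i`), defined for letters `1 ≤ i ≤ n-1`. -/
def adjTransp (n : ℕ) (i : ℕ) : Equiv.Perm (Fin n) :=
  if h : 1 ≤ i ∧ i < n then
    Equiv.swap ⟨i - 1, lt_of_le_of_lt (Nat.pred_le i) h.2⟩ ⟨i, h.2⟩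
  else 1

/-- The product `s_{i₁} ⋯ s_{i_m}` of the word `w = (i₁, …, i_m)`. -/
def wordProd (n : ℕ) (w : List ℕ) : Equiv.Perm (Fin n) :=
  (w.map (adjTransp n)).prod

/-- A word is a finite sequence of letters from `{1, …, n-1}`. -/
def IsWord (n : ℕ) (w : List ℕ) : Prop := ∀ i ∈ w, 1 ≤ i ∧ i ≤ n - 1

/-- A word is an expression for a permutation `p` if its product equals `p`. -/
def IsExpression (n : ℕ) (p : Equiv.Perm (Fin n)) (w : List ℕ) : Prop :=
  IsWord n w ∧ wordProd n w = p

/-- A reduced expression has minimal length among all expressions for `p`. -/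
def IsReducedExpr (n : ℕ) (p : Equiv.Perm (Fin n)) (w : List ℕ) : Prop :=
  IsExpression n p w ∧ ∀ w' : List ℕ, IsExpression n p w' → w.length ≤ w'.length

/-- The Coxeter length of `p`: minimal length of an expression for `p`. -/
noncomputable def coxLength (n : ℕ) (p : Equiv.Perm (Fin n)) : ℕ :=
  sInf {m | ∃ w : List ℕ, IsExpression n p w ∧ w.length = m}

/-- The longest element `w₀ : j ↦ n + 1 - j` (1-indexed), i.e. `Fin.rev` on `Fin n`. -/
def longestElem (n : ℕ) : Equiv.Perm (Fin n) := Fin.revPerm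
/-- A single commutation: swap two consecutive letters at distance ≥ 2. -/
def CommutationMove (u v : List ℕ) : Prop :=
  ∃ (x y : List ℕ) (a b : ℕ), 2 ≤ Nat.dist a b ∧
    u = x ++ [a, b] ++ y ∧ v = x ++ [b, a] ++ y

/-- All words of length `m` in the letters `1, 2, 3`. -/
def wordsOfLength : ℕ → List (List ℕ)
  | 0 => [[]]
  | m + 1 => [1, 2, 3].flatMap fun a => (wordsOfLength m).map (a :: ·)

theorem IsWord.mem_wordsOfLength {w : List ℕ} (h : IsWord 4 w) :
    w ∈ wordsOfLength w.length := by
  induction w with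
  | nil => simp [wordsOfLength]
  | cons a t ih =>
    have ha := h a (by simp)
    have ht : IsWord 4 t := fun i hi => h i (by simp [hi])
    have : a = 1 ∨ a = 2 ∨ a = 3 := by omega
    simpa [wordsOfLength, ih ht, eq_comm] using this

/-- The sixteen reduced expressions of the longest element of `S_4`. -/
def longestWords : List (List ℕ) :=
  [[1, 2, 1, 3, 2, 1], [1, 2, 3, 1, 2, 1], [1, 2, 3, 2, 1, 2], [1, 3, 2, 1, 3, 2],
   [1, 3, 2, 3, 1, 2], [2, 1, 2, 3, 2, 1], [2, 1, 3, 2, 1, 3], [2, 1, 3, 2, 3, 1],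
   [2, 3, 1, 2, 1, 3], [2, 3, 1, 2, 3, 1], [2, 3, 2, 1, 2, 3], [3, 1, 2, 1, 3, 2],
   [3, 1, 2, 3, 1, 2], [3, 2, 1, 2, 3, 2], [3, 2, 1, 3, 2, 3], [3, 2, 3, 1, 2, 3]]

theorem wordProd_ne_longestElem_of_length_lt :
    ∀ m < 6, ∀ w ∈ wordsOfLength m, wordProd 4 w ≠ longestElem 4 := by
  decide +kernel

theorem mem_longestWords_of_wordProd_eq :
    ∀ w ∈ wordsOfLength 6, wordProd 4 w = longestElem 4 → w ∈ longestWords := by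
  decide +kernel

theorem longestWords_spec :
    ∀ w ∈ longestWords, (∀ i ∈ w, 1 ≤ i ∧ i ≤ 4 - 1) ∧ wordProd 4 w = longestElem 4 ∧
      w.length = 6 := by
  decide +kernel

theorem IsExpression.six_le_length {w : List ℕ} (h : IsExpression 4 (longestElem 4) w) :
    6 ≤ w.length := by
  by_contra! hlt
  exact wordProd_ne_longestElem_of_length_lt _ hlt w h.1.mem_wordsOfLength h.2

theorem isReducedExpr_longestElem_iff {w : List ℕ} :
    IsReducedExpr 4 (longestElem 4) w ↔ w ∈ longestWords := by
  constructor
  · rintro ⟨hw, hmin⟩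
    obtain ⟨h₁, h₂, -⟩ := longestWords_spec [1, 2, 1, 3, 2, 1] (by decide)
    have hlen : w.length = 6 := le_antisymm (hmin _ ⟨h₁, h₂⟩) hw.six_le_length
    exact mem_longestWords_of_wordProd_eq w (hlen ▸ hw.1.mem_wordsOfLength) hw.2
  · intro hw
    obtain ⟨h₁, h₂, h₃⟩ := longestWords_spec w hw
    exact ⟨⟨h₁, h₂⟩, fun w' hw' => h₃ ▸ hw'.six_le_length⟩

/-- The subwords in the letters `{2, 3}` and `{1, 2}`. -/
def letterProjections (w : List ℕ) : List ℕ × List ℕ :=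
  (w.filter (· != 1), w.filter (· != 3))

theorem CommutationMove.letterProjections_eq {u v : List ℕ} (hu : IsWord 4 u)
    (h : CommutationMove u v) : letterProjections u = letterProjections v := by
  obtain ⟨x, y, a, b, hab, rfl, rfl⟩ := h
  have ha := hu a (by simp)
  have hb := hu b (by simp)
  have : a = 1 ∧ b = 3 ∨ a = 3 ∧ b = 1 := by
    unfold Nat.dist at hab
    omega
  rcases this with ⟨rfl, rfl⟩ | ⟨rfl, rfl⟩ <;> simp [letterProjections]

/-- The words obtained from a given word by a single commutation. -/
def commutationMoves : List ℕ → List (List ℕ)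
  | [] => []
  | [_] => []
  | a :: b :: t =>
    (if 2 ≤ Nat.dist a b then [b :: a :: t] else []) ++ (commutationMoves (b :: t)).map (a :: ·)

theorem CommutationMove.cons {u v : List ℕ} (a : ℕ) (h : CommutationMove u v) :
    CommutationMove (a :: u) (a :: v) := by
  obtain ⟨x, y, c, d, hcd, rfl, rfl⟩ := h
  exact ⟨a :: x, y, c, d, hcd, rfl, rfl⟩

theorem commutationMove_of_mem {u v : List ℕ} (h : v ∈ commutationMoves u) :
    CommutationMove u v := by
  induction u using commutationMoves.induct generalizing v with
  | case1 => simp [commutationMoves] at h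
  | case2 => simp [commutationMoves] at h
  | case3 a b t ih =>
    rw [commutationMoves, List.mem_append, List.mem_map] at h
    rcases h with h | ⟨w, hw, rfl⟩
    · split_ifs at h with hab
      · obtain rfl := List.mem_singleton.1 h
        exact ⟨[], t, a, b, hab, rfl, rfl⟩
      · simp at h
    · exact (ih hw).cons a

theorem connected_of_letterProjections_eq :
    ∀ u ∈ longestWords, ∀ v ∈ longestWords, letterProjections u = letterProjections v →
      u = v ∨ v ∈ commutationMoves u ∨
        ∃ x ∈ longestWords, x ∈ commutationMoves u ∧ v ∈ commutationMoves x := by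
  decide +kernel

theorem card_image_letterProjections :
    (longestWords.toFinset.image letterProjections).card = 8 := by
  decide +kernel

/-- The number of commutation classes of reduced expressions of the longest
element of S_4 is exactly 8. -/
theorem card_commClasses_S4 :
    Nat.card (Quot fun u v : {w : List ℕ // IsReducedExpr 4 (longestElem 4) w} =>
      CommutationMove u.1 v.1) = 8 := by
  let f : Quot (fun u v : {w : List ℕ // IsReducedExpr 4 (longestElem 4) w} =>
      CommutationMove u.1 v.1) → List ℕ × List ℕ :=
    Quot.lift (fun w => letterProjections w.1) fun u _ h => h.letterProjections_eq u.2.1.1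
  have hf : Function.Injective f := by
    rintro ⟨u, hu⟩ ⟨v, hv⟩ h
    rcases connected_of_letterProjections_eq u (isReducedExpr_longestElem_iff.1 hu) v
      (isReducedExpr_longestElem_iff.1 hv) h with rfl | h | ⟨x, hx, hux, hxv⟩
    · rfl
    · exact Quot.sound (commutationMove_of_mem h)
    · trans Quot.mk _ ⟨x, isReducedExpr_longestElem_iff.2 hx⟩
      · exact Quot.sound (commutationMove_of_mem hux)
      · exact Quot.sound (commutationMove_of_mem hxv)
  have hrange : Set.range f = (longestWords.toFinset.image letterProjections : Finset _) := by
    ext p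
    simp only [Set.mem_range, Finset.coe_image, Set.mem_image, Finset.mem_coe, List.mem_toFinset]
    constructor
    · rintro ⟨⟨w, hw⟩, rfl⟩
      exact ⟨w, isReducedExpr_longestElem_iff.1 hw, rfl⟩
    · rintro ⟨w, hw, rfl⟩
      exact ⟨Quot.mk _ ⟨w, isReducedExpr_longestElem_iff.2 hw⟩, rfl⟩
  rw [← Set.ncard_range_of_injective hf, hrange, Set.ncard_coe_finset,
    card_image_letterProjections]
end

section
/- (Felsner–Valtr upper bound) There exists N such that for all n ≥ N, the number c_n of commutation classes of reduced expressions of the longest element of S_n satisfies c_n ≤ 2^{0.6571·n²}. -/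
/-- The number of commutation classes of reduced expressions of the longest
element of `Sₙ`. -/
noncomputable def numCommClasses (n : ℕ) : ℕ :=
  Nat.card (Quot fun u v : {w : List ℕ // IsReducedExpr n (longestElem n) w} =>
    CommutationMove u.1 v.1)

namespace PseudolineCount

/-- The subword of `w` formed by the letters `k` and `k + 1`. -/
def proj (k : ℕ) (w : List ℕ) : List ℕ := w.filter fun i => decide (i = k ∨ i = k + 1)

theorem proj_append (k : ℕ) (u v : List ℕ) : proj k (u ++ v) = proj k u ++ proj k v := by
  simp [proj]

theorem proj_cons (k i : ℕ) (w : List ℕ) :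
    proj k (i :: w) = if i = k ∨ i = k + 1 then i :: proj k w else proj k w := by
  simp only [proj, List.filter_cons, decide_eq_true_eq]

theorem mem_proj {k i : ℕ} {w : List ℕ} : i ∈ proj k w ↔ i ∈ w ∧ (i = k ∨ i = k + 1) := by
  simp [proj]

theorem commutationMove_cons {u v : List ℕ} (a : ℕ) (h : CommutationMove u v) :
    CommutationMove (a :: u) (a :: v) := by
  obtain ⟨x, y, b, c, hbc, rfl, rfl⟩ := h
  exact ⟨a :: x, y, b, c, hbc, by simp, by simp⟩

theorem commutation_cons {u v : List ℕ} (a : ℕ)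
    (h : Relation.ReflTransGen CommutationMove u v) :
    Relation.ReflTransGen CommutationMove (a :: u) (a :: v) :=
  Relation.ReflTransGen.lift (a :: ·) (fun _ _ => commutationMove_cons a) _ _ h

theorem commutation_move_past {a : ℕ} (y : List ℕ) :
    ∀ x : List ℕ, (∀ b ∈ x, 2 ≤ Nat.dist a b) →
      Relation.ReflTransGen CommutationMove (a :: (x ++ y)) (x ++ a :: y)
  | [], _ => Relation.ReflTransGen.refl
  | b :: x, h => by
    refine Relation.ReflTransGen.head ?_
      (commutation_cons b (commutation_move_past y x fun c hc => h c (List.mem_cons_of_mem _ hc)))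
    exact ⟨[], x ++ y, a, b, h b List.mem_cons_self, by simp, by simp⟩

/-- Two words with the same projections to all pairs of non-commuting letters are related by
commutations. -/
theorem commutation_of_proj_eq :
    ∀ u v : List ℕ, (∀ k, proj k u = proj k v) → Relation.ReflTransGen CommutationMove u v
  | [], v, h => by
    cases v with
    | nil => exact Relation.ReflTransGen.refl
    | cons b v => simpa [proj] using h b
  | a :: u, v, h => by
    have ha : a ∈ v := (mem_proj.1 (by rw [← h a]; simp [proj] : a ∈ proj a v)).1
    obtain ⟨x, y, rfl, hax⟩ := List.eq_append_cons_of_mem ha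
    have hx : ∀ b ∈ x, ∀ k, (b = k ∨ b = k + 1) → ¬ (a = k ∨ a = k + 1) := by
      intro b hb k hbk hak
      have hk := h k
      rw [proj_cons, if_pos hak, proj_append] at hk
      have hbm : b ∈ proj k x := mem_proj.2 ⟨hb, hbk⟩
      cases hp : proj k x with
      | nil => simp [hp] at hbm
      | cons c z =>
        rw [hp] at hk
        have hac : a = c := by simpa using (List.cons.inj hk).1
        exact hax (mem_proj.1 (by rw [hp, hac]; simp : a ∈ proj k x)).1
    have hdist : ∀ b ∈ x, 2 ≤ Nat.dist a b := by
      intro b hb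
      have h1 := hx b hb a
      have h2 := hx b hb b
      unfold Nat.dist
      omega
    refine (commutation_cons a (commutation_of_proj_eq u (x ++ y) fun k => ?_)).trans
      (commutation_move_past y x hdist)
    have hk := h k
    rw [proj_cons, proj_append, proj_cons] at hk
    rw [proj_append]
    split_ifs at hk with hak
    · have hnil : proj k x = [] := by
        rw [List.eq_nil_iff_forall_not_mem]
        intro b hb
        exact hx b (mem_proj.1 hb).1 k (mem_proj.1 hb).2 hak
      rw [hnil] at hk ⊢
      simpa using hk
    · exact hk

/-- The permutation of positions `s_{i₁} ⋯ s_{i_m}`, acting on all of `ℕ`: it sends a position to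
the line found there after reading the word. -/
def arr (w : List ℕ) : Equiv.Perm ℕ := (w.map fun i => Equiv.swap (i - 1) i).prod

@[simp] theorem arr_nil : arr [] = 1 := rfl

theorem arr_cons (i : ℕ) (w : List ℕ) : arr (i :: w) = Equiv.swap (i - 1) i * arr w := by
  simp [arr]

theorem arr_append (u v : List ℕ) : arr (u ++ v) = arr u * arr v := by
  simp [arr]

theorem wordProd_apply_val {n : ℕ} :
    ∀ {w : List ℕ}, IsWord n w → ∀ q : Fin n, ((wordProd n w q : Fin n) : ℕ) = arr w q
  | [], _, q => by simp [wordProd]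
  | i :: w, h, q => by
    have hi := h i List.mem_cons_self
    have ih := wordProd_apply_val (fun j hj => h j (List.mem_cons_of_mem _ hj) : IsWord n w) q
    have hi' : 1 ≤ i ∧ i < n := by omega
    have hw : wordProd n (i :: w) q = adjTransp n i (wordProd n w q) := by simp [wordProd]
    rw [hw, arr_cons, Equiv.Perm.mul_apply, ← ih, adjTransp, dif_pos hi']
    simp only [Equiv.swap_apply_def, Fin.ext_iff]
    split_ifs <;> rfl

theorem arr_apply_of_le {n : ℕ} {w : List ℕ} (h : ∀ i ∈ w, 1 ≤ i ∧ i < n) {q : ℕ} (hq : n ≤ q) :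
    arr w q = q := by
  induction w with
  | nil => rfl
  | cons i w ih =>
    have hi := h i List.mem_cons_self
    rw [arr_cons, Equiv.Perm.mul_apply, ih fun j hj => h j (List.mem_cons_of_mem _ hj)]
    exact Equiv.swap_apply_of_ne_of_ne (by omega) (by omega)

theorem arr_apply_lt {n : ℕ} {w : List ℕ} (h : ∀ i ∈ w, 1 ≤ i ∧ i < n) {q : ℕ} (hq : q < n) :
    arr w q < n := by
  by_contra hc
  have := (arr w).injective (arr_apply_of_le h (not_lt.1 hc))
  omega

/-- Words for the longest element in which every letter swaps an ascent. -/
structure IsSweep (n : ℕ) (w : List ℕ) : Prop where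
  letters : ∀ i ∈ w, 1 ≤ i ∧ i < n
  ascent : ∀ u i v, w = u ++ i :: v → arr u (i - 1) < arr u i
  final : ∀ q < n, arr w q = n - 1 - q

/-- The pairs of lines below `n` that have crossed after reading `w`. -/
def crossed (n : ℕ) (w : List ℕ) : Finset (ℕ × ℕ) :=
  (Finset.range n ×ˢ Finset.range n).filter fun x => x.1 < x.2 ∧ (arr w)⁻¹ x.2 < (arr w)⁻¹ x.1

theorem mem_crossed {n : ℕ} {w : List ℕ} {a b : ℕ} :
    (a, b) ∈ crossed n w ↔ b < n ∧ a < b ∧ (arr w)⁻¹ b < (arr w)⁻¹ a := by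
  simp only [crossed, Finset.mem_filter, Finset.mem_product, Finset.mem_range]
  constructor
  · tauto
  · intro h
    exact ⟨⟨by omega, by omega⟩, h.2⟩

theorem arr_concat_inv (u : List ℕ) (i a : ℕ) :
    (arr (u ++ [i]))⁻¹ a = Equiv.swap (i - 1) i ((arr u)⁻¹ a) := by
  rw [arr_append, mul_inv_rev, Equiv.Perm.mul_apply, arr_cons, arr_nil, mul_one, Equiv.swap_inv]

theorem swap_lt_swap {i p q : ℕ} (hpq : p < q) (h : ¬ (p = i - 1 ∧ q = i)) :
    Equiv.swap (i - 1) i p < Equiv.swap (i - 1) i q := by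
  simp only [Equiv.swap_apply_def]
  split_ifs <;> omega

theorem crossed_concat_subset (n : ℕ) (u : List ℕ) (i : ℕ) :
    crossed n (u ++ [i]) ⊆ insert (arr u (i - 1), arr u i) (crossed n u) := by
  rintro ⟨a, b⟩ h
  rw [mem_crossed, arr_concat_inv, arr_concat_inv] at h
  rw [Finset.mem_insert, mem_crossed]
  by_contra! hc
  obtain ⟨hb, hab, hlt⟩ := h
  have hle := hc.2 hb hab
  have hne : (arr u)⁻¹ a ≠ (arr u)⁻¹ b := fun he => hab.ne ((arr u)⁻¹.injective he)
  refine absurd (swap_lt_swap (lt_of_le_of_ne hle hne) ?_) hlt.le.not_gt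
  rintro ⟨h1, h2⟩
  exact hc.1 (Prod.ext (by rw [← h1]; simp) (by rw [← h2]; simp))

theorem crossed_concat_subset_of_descent {n : ℕ} {u : List ℕ} {i : ℕ}
    (hd : arr u i ≤ arr u (i - 1)) : crossed n (u ++ [i]) ⊆ crossed n u := by
  intro x hx
  rcases Finset.mem_insert.1 (crossed_concat_subset n u i hx) with rfl | h
  · exact absurd (mem_crossed.1 hx).2.1 hd.not_gt
  · exact h

theorem card_crossed_append_le (n : ℕ) (u v : List ℕ) :
    (crossed n (u ++ v)).card ≤ (crossed n u).card + v.length := by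
  induction v using List.reverseRecOn with
  | nil => simp
  | append_singleton v i ih =>
    rw [← List.append_assoc]
    have h := (Finset.card_le_card (crossed_concat_subset n (u ++ v) i)).trans
      (Finset.card_insert_le _ _)
    simp only [List.length_append, List.length_singleton]
    omega

theorem crossed_nil (n : ℕ) : crossed n [] = ∅ := by
  ext ⟨a, b⟩
  simp only [mem_crossed, arr_nil, inv_one, Equiv.Perm.one_apply, Finset.notMem_empty, iff_false]
  omega

theorem descWord_apply (n : ℕ) :
    arr ((List.range n).map (· + 1)).reverse 0 = n ∧
      (∀ q, q + 1 ≤ n → arr ((List.range n).map (· + 1)).reverse (q + 1) = q) ∧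
      ∀ q, n < q → arr ((List.range n).map (· + 1)).reverse q = q := by
  induction n with
  | zero => simp
  | succ n ih =>
    have hr : ((List.range (n + 1)).map (· + 1)).reverse
        = (n + 1) :: ((List.range n).map (· + 1)).reverse := by
      simp [List.range_succ]
    obtain ⟨h1, h2, h3⟩ := ih
    rw [hr]
    simp only [arr_cons, Equiv.Perm.mul_apply]
    refine ⟨by rw [h1]; simp, fun q hq => ?_, fun q hq => ?_⟩
    · rcases Nat.lt_or_ge n (q + 1) with h | h
      · rw [h3 _ h, show q = n by omega]
        simp
      · rw [h2 q h]
        exact Equiv.swap_apply_of_ne_of_ne (by omega) (by omega)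
    · rw [h3 q (by omega)]
      exact Equiv.swap_apply_of_ne_of_ne (by omega) (by omega)

theorem exists_word_longestElem (n : ℕ) :
    ∃ w : List ℕ, (∀ i ∈ w, 1 ≤ i ∧ i < n) ∧ (∀ q < n, arr w q = n - 1 - q) ∧
      w.length = n.choose 2 := by
  induction n with
  | zero => exact ⟨[], by simp⟩
  | succ n ih =>
    obtain ⟨w, h1, h2, h3⟩ := ih
    obtain ⟨d1, d2, -⟩ := descWord_apply n
    refine ⟨w ++ ((List.range n).map (· + 1)).reverse, ?_, ?_, ?_⟩
    · intro i hi
      rcases List.mem_append.1 hi with hi | hi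
      · have := h1 i hi
        omega
      · simp at hi
        omega
    · rintro (_ | q) hq
      · rw [arr_append, Equiv.Perm.mul_apply, d1, arr_apply_of_le h1 le_rfl]
        omega
      · rw [arr_append, Equiv.Perm.mul_apply, d2 q (by omega), h2 q (by omega)]
        omega
    · simp [h3, Nat.choose_succ_succ' n 1, add_comm]

theorem isExpression_longestElem_iff {n : ℕ} {w : List ℕ} :
    IsExpression n (longestElem n) w ↔
      (∀ i ∈ w, 1 ≤ i ∧ i < n) ∧ ∀ q < n, arr w q = n - 1 - q := by
  have hl : IsWord n w ↔ ∀ i ∈ w, 1 ≤ i ∧ i < n :=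
    forall₂_congr fun i _ => by omega
  rw [IsExpression, ← hl, Equiv.ext_iff]
  refine and_congr_right fun hw => ⟨fun h q hq => ?_, fun h q => ?_⟩
  · have := congrArg Fin.val (h ⟨q, hq⟩)
    rw [wordProd_apply_val hw] at this
    simp only [longestElem, Fin.revPerm_apply, Fin.val_rev] at this
    omega
  · apply Fin.ext
    rw [wordProd_apply_val hw, h q q.2]
    simp only [longestElem, Fin.revPerm_apply, Fin.val_rev]
    omega

theorem choose_two_le_card_crossed {n : ℕ} {w : List ℕ} (h : ∀ q < n, arr w q = n - 1 - q) :
    n.choose 2 ≤ (crossed n w).card := by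
  have hinv : ∀ a < n, (arr w)⁻¹ a = n - 1 - a := by
    intro a ha
    rw [Equiv.Perm.inv_eq_iff_eq, h _ (by omega)]
    omega
  have hcard : ((Finset.range n).sigma fun b => Finset.range b).card = n.choose 2 := by
    rw [Finset.card_sigma]
    simp only [Finset.card_range]
    rw [Finset.sum_range_id, Nat.choose_two_right]
  rw [← hcard]
  refine Finset.card_le_card_of_injOn (fun x => (x.2, x.1)) ?_ ?_
  · rintro ⟨b, a⟩ hx
    simp only [Finset.coe_sigma, Set.mem_sigma_iff, Finset.coe_range, Set.mem_Iio] at hx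
    rw [Finset.mem_coe, mem_crossed]
    refine ⟨hx.1, hx.2, ?_⟩
    dsimp only
    rw [hinv _ hx.1, hinv _ (hx.2.trans hx.1)]
    omega
  · rintro ⟨b, a⟩ - ⟨d, c⟩ - hx
    simp_all

/-- Reduced expressions of the longest element only swap ascents. -/
theorem isSweep_of_isReducedExpr {n : ℕ} {w : List ℕ}
    (h : IsReducedExpr n (longestElem n) w) : IsSweep n w := by
  obtain ⟨hl, hf⟩ := isExpression_longestElem_iff.1 h.1
  refine ⟨hl, fun u i v hw => ?_, hf⟩
  by_contra! hd
  obtain ⟨w', h1, h2, h3⟩ := exists_word_longestElem n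
  have hlen := h.2 w' (isExpression_longestElem_iff.2 ⟨h1, h2⟩)
  have hu := card_crossed_append_le n [] u
  have hi := Finset.card_le_card (crossed_concat_subset_of_descent (n := n) hd)
  have hv := card_crossed_append_le n (u ++ [i]) v
  have hw' : w = u ++ [i] ++ v := by simpa using hw
  have hc := choose_two_le_card_crossed hf
  rw [← hw'] at hv
  rw [crossed_nil] at hu
  have := congrArg List.length hw'
  simp at this hu
  omega

theorem isReducedExpr_of_commutationMove {n : ℕ} {p : Equiv.Perm (Fin n)} {u v : List ℕ}
    (hu : IsReducedExpr n p u) (h : CommutationMove u v) : IsReducedExpr n p v := by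
  obtain ⟨x, y, a, b, hab, rfl, rfl⟩ := h
  obtain ⟨⟨hw, hp⟩, hmin⟩ := hu
  have hcomm : adjTransp n a * adjTransp n b = adjTransp n b * adjTransp n a := by
    unfold adjTransp
    split_ifs with h1 h2
    · apply Equiv.Perm.Disjoint.commute
      intro q
      simp only [Equiv.swap_apply_def, Fin.ext_iff]
      unfold Nat.dist at hab
      split_ifs <;> omega
    all_goals simp
  refine ⟨⟨fun i hi => hw i (by simp at hi ⊢; tauto), ?_⟩, fun w' hw' => by simpa using hmin w' hw'⟩
  rw [← hp]
  simp only [wordProd, List.map_append, List.prod_append, List.map_cons, List.map_nil,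
    List.prod_cons, List.prod_nil, mul_one, hcomm]

/-- Bounding the number of commutation classes by any set of words representing all systems of
projections. -/
theorem numCommClasses_le {n : ℕ} (F : Finset (List ℕ))
    (hF : ∀ w, IsSweep n w → ∃ u ∈ F, ∀ k, proj k u = proj k w) :
    numCommClasses n ≤ F.card := by
  choose! f hfF hf using hF
  let R := fun u v : {w : List ℕ // IsReducedExpr n (longestElem n) w} => CommutationMove u.1 v.1
  let φ : Quot R → F := fun q =>
    ⟨f q.out.1, hfF _ (isSweep_of_isReducedExpr q.out.2)⟩
  have key : ∀ u v : List ℕ, Relation.ReflTransGen CommutationMove u v →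
      ∀ (hu : IsReducedExpr n (longestElem n) u), ∃ hv : IsReducedExpr n (longestElem n) v,
        Quot.mk R ⟨u, hu⟩ = Quot.mk R ⟨v, hv⟩ := by
    intro u v huv hu
    induction huv with
    | refl => exact ⟨hu, rfl⟩
    | tail _ hmove ih =>
      obtain ⟨hb, he⟩ := ih
      exact ⟨isReducedExpr_of_commutationMove hb hmove, he.trans (Quot.sound hmove)⟩
  have hφ : Function.Injective φ := by
    intro q q' hqq
    have he : f q.out.1 = f q'.out.1 := congrArg Subtype.val hqq
    have hp : ∀ k, proj k q.out.1 = proj k q'.out.1 := fun k => by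
      rw [← hf _ (isSweep_of_isReducedExpr q.out.2), he, hf _ (isSweep_of_isReducedExpr q'.out.2)]
    obtain ⟨_, h⟩ := key _ _ (commutation_of_proj_eq _ _ hp) q.out.2
    rw [← q.out_eq, ← q'.out_eq]
    exact h
  have := Nat.card_le_card_of_injective φ hφ
  simpa [numCommClasses] using this

/-- `Crosses p w`: reading `w`, the line that starts at position `p` moves down to position `0`,
and never up. -/
inductive Crosses : ℕ → List ℕ → Prop
  | nil : Crosses 0 []
  | cross {p : ℕ} {w : List ℕ} : Crosses p w → Crosses (p + 1) ((p + 1) :: w)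
  | low {p i : ℕ} {w : List ℕ} : i < p → Crosses p w → Crosses p (i :: w)
  | high {p i : ℕ} {w : List ℕ} : p + 1 < i → Crosses p w → Crosses p (i :: w)

/-- The word obtained from `w` by deleting the line that starts at position `p` and moves down. -/
def del : ℕ → List ℕ → List ℕ
  | _, [] => []
  | p, i :: w =>
    if i = p then del (p - 1) w else if i < p then i :: del p w else (i - 1) :: del p w

/-- `cutCount p w j` is the number of letters `j` in `del p w` that occur before the deleted line
leaves position `j`. -/
def cutCount : ℕ → List ℕ → ℕ → ℕ
  | _, [], _ => 0
  | p, i :: w, j =>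
    if i = p then cutCount (p - 1) w j
    else if i < p then cutCount p w j + (if i = j then 1 else 0) else cutCount p w j

theorem del_cross (p : ℕ) (w : List ℕ) : del (p + 1) ((p + 1) :: w) = del p w := by
  simp [del]

theorem del_below {p i : ℕ} (h : i < p) (w : List ℕ) : del p (i :: w) = i :: del p w := by
  rw [del, if_neg h.ne, if_pos h]

theorem del_above {p i : ℕ} (h : p + 1 < i) (w : List ℕ) :
    del p (i :: w) = (i - 1) :: del p w := by
  rw [del, if_neg (by omega), if_neg (by omega)]

theorem cutCount_cross (p : ℕ) (w : List ℕ) (j : ℕ) :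
    cutCount (p + 1) ((p + 1) :: w) j = cutCount p w j := by
  simp [cutCount]

theorem cutCount_below {p i : ℕ} (h : i < p) (w : List ℕ) (j : ℕ) :
    cutCount p (i :: w) j = cutCount p w j + if i = j then 1 else 0 := by
  rw [cutCount, if_neg h.ne, if_pos h]

theorem cutCount_above {p i : ℕ} (h : p + 1 < i) (w : List ℕ) (j : ℕ) :
    cutCount p (i :: w) j = cutCount p w j := by
  rw [cutCount, if_neg (by omega), if_neg (by omega)]

theorem cutCount_eq_zero {p : ℕ} {w : List ℕ} (h : Crosses p w) :
    ∀ {j : ℕ}, p ≤ j → cutCount p w j = 0 := by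
  induction h with
  | nil => intro j _; rfl
  | cross _ ih => intro j hj; rw [cutCount_cross, ih (by omega)]
  | low hi _ ih => intro j hj; rw [cutCount_below hi, ih hj, if_neg (by omega)]
  | high hi _ ih => intro j hj; rw [cutCount_above hi, ih hj]

/-- `g` records a cutpath of the arrangement with word `w`: `g j` is the index of the gap at
level `j` visited by the path, and consecutive gaps are adjacent. -/
structure IsCut (m : ℕ) (w : List ℕ) (g : ℕ → ℕ) : Prop where
  zero : g 0 = 0
  adj : ∀ j < m, ∃ x, x <+: w ∧ x.count j = g j ∧ x.count (j + 1) = g (j + 1)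
  top : ∀ j, m < j → g j = 0

theorem cutCount_adj {p : ℕ} {w : List ℕ} (h : Crosses p w) :
    ∀ j < p, ∃ x, x <+: del p w ∧ x.count j = cutCount p w j ∧
      x.count (j + 1) = cutCount p w (j + 1) := by
  induction h with
  | nil => intro j hj; omega
  | @cross p w hw ih =>
    intro j hj
    simp only [del_cross, cutCount_cross]
    rcases Nat.lt_succ_iff_lt_or_eq.1 hj with hj | rfl
    · exact ih j hj
    · exact ⟨[], List.nil_prefix, by rw [cutCount_eq_zero hw le_rfl]; rfl,
        by rw [cutCount_eq_zero hw (Nat.le_succ _)]; rfl⟩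
  | @low p i w hi hw ih =>
    intro j hj
    obtain ⟨x, h1, h2, h3⟩ := ih j hj
    simp only [del_below hi, cutCount_below hi]
    refine ⟨i :: x, (List.prefix_cons_inj _).2 h1, ?_, ?_⟩
    · simp [List.count_cons, h2]
    · simp [List.count_cons, h3]
  | @high p i w hi hw ih =>
    intro j hj
    obtain ⟨x, h1, h2, h3⟩ := ih j hj
    simp only [del_above hi, cutCount_above hi]
    refine ⟨(i - 1) :: x, (List.prefix_cons_inj _).2 h1, ?_, ?_⟩
    · rw [List.count_cons_of_ne (by omega), h2]
    · rw [List.count_cons_of_ne (by omega), h3]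

/-- The projections of a word are recovered from those of the word with a line deleted, together
with the cutpath of that line. -/
theorem proj_eq_of_crosses {p : ℕ} {w : List ℕ} (h : Crosses p w) {k : ℕ} (hk : 1 ≤ k) :
    proj k w =
      if k < p then
        (proj k (del p w)).take (cutCount p w k + cutCount p w (k + 1)) ++ (k + 1) :: k ::
          ((proj (k - 1) (del p w)).drop (cutCount p w (k - 1) + cutCount p w k)).map (· + 1)
      else if k = p then
        k :: ((proj (k - 1) (del p w)).drop (cutCount p w (k - 1))).map (· + 1)
      else (proj (k - 1) (del p w)).map (· + 1) := by
  induction h with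
  | nil => simp [proj, del, show k ≠ 0 by omega]
  | @cross p w hw ih =>
    simp only [del_cross, cutCount_cross]
    rw [proj_cons, ih]
    rcases lt_trichotomy k p with hkp | rfl | hkp
    · rw [if_neg (by omega), if_pos hkp, if_pos (by omega)]
    · simp [cutCount_eq_zero hw]
    · rcases Nat.lt_or_ge (p + 1) k with h | h
      · rw [if_neg (by omega), if_neg (by omega), if_neg (by omega), if_neg (by omega),
          if_neg (by omega)]
      · obtain rfl : k = p + 1 := by omega
        simp [cutCount_eq_zero hw]
  | @low p i w hi hw ih =>
    simp only [del_below hi, cutCount_below hi]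
    simp only [proj_cons, ih]
    have h1 : cutCount p w (k - 1) + (if i = k - 1 then 1 else 0) +
        (cutCount p w k + if i = k then 1 else 0) = (cutCount p w (k - 1) + cutCount p w k) +
        if i = k - 1 ∨ i = k - 1 + 1 then 1 else 0 := by
      split_ifs <;> omega
    have h2 : cutCount p w k + (if i = k then 1 else 0) +
        (cutCount p w (k + 1) + if i = k + 1 then 1 else 0) =
        (cutCount p w k + cutCount p w (k + 1)) + if i = k ∨ i = k + 1 then 1 else 0 := by
      split_ifs <;> omega
    simp only [h1, h2]
    rcases lt_trichotomy k p with hkp | rfl | hkp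
    · simp only [if_pos hkp]
      split_ifs <;> simp
    · simp only [lt_irrefl, if_false, if_true]
      rw [if_neg (by omega)]
      have : (i = k - 1 ∨ i = k - 1 + 1) ↔ i = k - 1 := by omega
      simp only [this]
      split_ifs <;> simp
    · rw [if_neg (by omega), if_neg (by omega), if_neg (by omega), if_neg (by omega),
        if_neg (by omega), if_neg (by omega)]
  | @high p i w hi hw ih =>
    simp only [del_above hi, cutCount_above hi]
    simp only [proj_cons, ih]
    rcases lt_trichotomy k p with hkp | rfl | hkp
    · rw [if_neg (show ¬ (i = k ∨ i = k + 1) by omega),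
        if_neg (show ¬ (i - 1 = k ∨ i - 1 = k + 1) by omega),
        if_neg (show ¬ (i - 1 = k - 1 ∨ i - 1 = k - 1 + 1) by omega)]
    · rw [if_neg (show ¬ (i = k ∨ i = k + 1) by omega),
        if_neg (show ¬ (i - 1 = k - 1 ∨ i - 1 = k - 1 + 1) by omega)]
      simp
    · rw [if_neg (show ¬ k < p by omega), if_neg (show ¬ k < p by omega),
        if_neg (show ¬ k = p by omega), if_neg (show ¬ k = p by omega)]
      have : (i - 1 = k - 1 ∨ i - 1 = k - 1 + 1) ↔ (i = k ∨ i = k + 1) := by omega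
      simp only [this]
      split_ifs
      · simp only [List.map_cons, List.cons.injEq, and_true]
        omega
      · rfl

theorem proj_zero_eq {w : List ℕ} (h : ∀ i ∈ w, 1 ≤ i) :
    proj 0 w = (proj 1 w).filter fun i => decide (i = 1) := by
  rw [proj, proj, List.filter_filter]
  refine List.filter_congr fun i hi => ?_
  have := h i hi
  rw [Bool.eq_iff_iff]
  simp
  omega

theorem proj_eq_of_del_eq {p : ℕ} {v w : List ℕ} (hv : Crosses p v) (hw : Crosses p w)
    (hv1 : ∀ i ∈ v, 1 ≤ i) (hw1 : ∀ i ∈ w, 1 ≤ i)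
    (hd : ∀ k, proj k (del p v) = proj k (del p w)) (hc : cutCount p v = cutCount p w) (k : ℕ) :
    proj k v = proj k w := by
  have h : ∀ k, 1 ≤ k → proj k v = proj k w := fun k hk => by
    rw [proj_eq_of_crosses hv hk, proj_eq_of_crosses hw hk, hd, hd, hc]
  rcases Nat.eq_zero_or_pos k with rfl | hk
  · rw [proj_zero_eq hv1, proj_zero_eq hw1, h 1 le_rfl]
  · exact h k hk

theorem count_proj {k i : ℕ} (h : i = k ∨ i = k + 1) (w : List ℕ) :
    (proj k w).count i = w.count i := by
  rw [proj, List.count_filter]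
  simpa using h

theorem IsCut.of_proj_eq {m : ℕ} {v w : List ℕ} {g : ℕ → ℕ} (h : ∀ k, proj k v = proj k w)
    (hg : IsCut m v g) : IsCut m w g := by
  refine ⟨hg.zero, fun j hj => ?_, hg.top⟩
  obtain ⟨x, ⟨y, rfl⟩, h2, h3⟩ := hg.adj j hj
  have hp := (h j).symm
  rw [proj_append, proj, List.filter_eq_append_iff] at hp
  obtain ⟨x', y', rfl, hx, -⟩ := hp
  replace hx : proj j x' = proj j x := hx
  refine ⟨x', List.prefix_append _ _, ?_, ?_⟩
  · rw [← count_proj (Or.inl rfl) x', hx, count_proj (Or.inl rfl), h2]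
  · rw [← count_proj (Or.inr rfl) x', hx, count_proj (Or.inr rfl), h3]

theorem arr_concat (u : List ℕ) (i q : ℕ) :
    arr (u ++ [i]) q = arr u (Equiv.swap (i - 1) i q) := by
  simp [arr_append, arr_cons]

theorem sweep_del_aux {n : ℕ} {w : List ℕ} (hw : IsSweep (n + 1) w) :
    ∀ (v u u' : List ℕ) (p : ℕ), w = u ++ v → arr u p = n → p ≤ n →
      (∀ q < n, arr u' q = if q < p then arr u q else arr u (q + 1)) →
      Crosses p v ∧ (∀ i ∈ del p v, 1 ≤ i ∧ i < n) ∧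
        (∀ x i y, del p v = x ++ i :: y → arr (u' ++ x) (i - 1) < arr (u' ++ x) i) ∧
        ∀ q < n, arr (u' ++ del p v) q = n - 1 - q
  | [], u, u', p, hwu, hp, hpn, hq => by
    rw [List.append_nil] at hwu
    have hp0 : p = 0 := by
      have := hw.final p (by omega)
      rw [hwu, hp] at this
      omega
    subst hp0
    refine ⟨Crosses.nil, by simp [del], by simp [del], fun q hqn => ?_⟩
    have := hw.final (q + 1) (by omega)
    rw [hwu] at this
    rw [del, List.append_nil, hq q hqn, if_neg (by omega), this]
    omega
  | i :: v, u, u', p, hwu, hp, hpn, hq => by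
    have hi := hw.letters i (by rw [hwu]; simp)
    have hasc := hw.ascent u i v hwu
    have hul : ∀ j ∈ u, 1 ≤ j ∧ j < n + 1 := fun j hj => hw.letters j (by rw [hwu]; simp [hj])
    have hlt : ∀ q, q < n + 1 → arr u q < n + 1 := fun q hq => arr_apply_lt hul hq
    have hwu' : w = (u ++ [i]) ++ v := by simpa using hwu
    have hip : i ≠ p + 1 := by
      rintro rfl
      have := hlt (p + 1) (by omega)
      rw [Nat.add_sub_cancel, hp] at hasc
      omega
    rcases lt_trichotomy i p with h | rfl | h
    · obtain ⟨h1, h2, h3, h4⟩ := sweep_del_aux hw v (u ++ [i]) (u' ++ [i]) p hwu'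
        (by rw [arr_concat, Equiv.swap_apply_of_ne_of_ne (by omega) (by omega), hp]) hpn
        (fun q hqn => by
          simp only [arr_concat]
          rw [hq _ (by rw [Equiv.swap_apply_def]; split_ifs <;> omega)]
          simp only [Equiv.swap_apply_def]
          split_ifs <;> first | rfl | omega)
      rw [del_below h]
      refine ⟨Crosses.low h h1, ?_, ?_, ?_⟩
      · simp only [List.mem_cons, forall_eq_or_imp]
        exact ⟨by omega, h2⟩
      · rintro (_ | ⟨a, x⟩) j y hxy
        · simp only [List.nil_append, List.cons.injEq] at hxy
          obtain ⟨rfl, rfl⟩ := hxy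
          rw [List.append_nil, hq _ (by omega), hq _ (by omega), if_pos (by omega), if_pos h]
          exact hasc
        · simp only [List.cons_append, List.cons.injEq] at hxy
          obtain ⟨rfl, hxy⟩ := hxy
          simpa using h3 x j y hxy
      · simpa using h4
    · obtain ⟨p, rfl⟩ : ∃ p, i = p + 1 := ⟨i - 1, by omega⟩
      obtain ⟨h1, h2, h3, h4⟩ := sweep_del_aux hw v (u ++ [p + 1]) u' p hwu'
        (by rw [arr_concat, Nat.add_sub_cancel, Equiv.swap_apply_left, hp]) (by omega)
        (fun q hqn => by
          simp only [arr_concat]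
          rw [hq _ hqn]
          simp only [Equiv.swap_apply_def]
          split_ifs <;> first | rfl | omega | (congr 1; omega))
      rw [del_cross]
      exact ⟨Crosses.cross h1, h2, h3, h4⟩
    · have h : p + 1 < i := by omega
      obtain ⟨h1, h2, h3, h4⟩ := sweep_del_aux hw v (u ++ [i]) (u' ++ [i - 1]) p hwu'
        (by rw [arr_concat, Equiv.swap_apply_of_ne_of_ne (by omega) (by omega), hp]) hpn
        (fun q hqn => by
          simp only [arr_concat]
          rw [hq _ (by rw [Equiv.swap_apply_def]; split_ifs <;> omega)]
          simp only [Equiv.swap_apply_def]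
          split_ifs <;> first | rfl | omega | (congr 1; omega))
      rw [del_above h]
      refine ⟨Crosses.high h h1, ?_, ?_, ?_⟩
      · simp only [List.mem_cons, forall_eq_or_imp]
        exact ⟨by omega, h2⟩
      · rintro (_ | ⟨a, x⟩) j y hxy
        · simp only [List.nil_append, List.cons.injEq] at hxy
          obtain ⟨rfl, rfl⟩ := hxy
          rw [List.append_nil, hq _ (by omega), hq _ (by omega), if_neg (by omega),
            if_neg (by omega), show i - 1 - 1 + 1 = i - 1 by omega, show i - 1 + 1 = i by omega]
          exact hasc
        · simp only [List.cons_append, List.cons.injEq] at hxy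
          obtain ⟨rfl, hxy⟩ := hxy
          simpa using h3 x j y hxy
      · simpa using h4

theorem IsSweep.crosses_and_del {n : ℕ} {w : List ℕ} (hw : IsSweep (n + 1) w) :
    Crosses n w ∧ IsSweep n (del n w) := by
  obtain ⟨h1, h2, h3, h4⟩ := sweep_del_aux hw w [] [] n rfl rfl le_rfl
    (fun q hq => by rw [if_pos hq])
  exact ⟨h1, h2, h3, h4⟩

theorem IsSweep.isCut {n : ℕ} {w : List ℕ} (hw : IsSweep (n + 1) w) :
    IsCut n (del n w) (cutCount n w) := by
  obtain ⟨hc, hd⟩ := hw.crosses_and_del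
  refine ⟨?_, cutCount_adj hc, fun j hj => cutCount_eq_zero hc hj.le⟩
  rcases Nat.eq_zero_or_pos n with rfl | hn
  · exact cutCount_eq_zero hc le_rfl
  · obtain ⟨x, hx, h0, -⟩ := cutCount_adj hc 0 hn
    rw [← h0, List.count_eq_zero]
    intro h
    exact absurd (hd.letters 0 (hx.subset h)).1 (by norm_num)

/-- The number of letters `j` among the first `t` letters of `w`. -/
def cnt (w : List ℕ) (j t : ℕ) : ℕ := (w.take t).count j

/-- The position of line `l` after reading the first `t` letters of `w`. -/
def pos (w : List ℕ) (t l : ℕ) : ℕ := (arr (w.take t))⁻¹ l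

theorem cnt_succ {w : List ℕ} {t : ℕ} (ht : t < w.length) (j : ℕ) :
    cnt w j (t + 1) = cnt w j t + if w[t] = j then 1 else 0 := by
  rw [cnt, List.take_succ_eq_append_getElem ht, List.count_append, List.count_singleton, cnt]
  simp

theorem cnt_succ_of_le {w : List ℕ} {t : ℕ} (ht : w.length ≤ t) (j : ℕ) :
    cnt w j (t + 1) = cnt w j t := by
  rw [cnt, cnt, List.take_of_length_le ht, List.take_of_length_le (by omega)]

theorem cnt_mono (w : List ℕ) (j : ℕ) : Monotone (cnt w j) := by
  refine monotone_nat_of_le_succ fun t => ?_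
  rcases Nat.lt_or_ge t w.length with h | h
  · rw [cnt_succ h]
    omega
  · rw [cnt_succ_of_le h]

theorem pos_succ {w : List ℕ} {t : ℕ} (ht : t < w.length) (l : ℕ) :
    pos w (t + 1) l = Equiv.swap (w[t] - 1) w[t] (pos w t l) := by
  rw [pos, List.take_succ_eq_append_getElem ht, arr_concat_inv, pos]

theorem pos_succ_of_le {w : List ℕ} {t : ℕ} (ht : w.length ≤ t) (l : ℕ) :
    pos w (t + 1) l = pos w t l := by
  rw [pos, pos, List.take_of_length_le ht, List.take_of_length_le (by omega)]

theorem arr_take_pos (w : List ℕ) (t l : ℕ) : arr (w.take t) (pos w t l) = l :=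
  (arr (w.take t)).apply_symm_apply l

theorem pos_injective (w : List ℕ) (t : ℕ) : Function.Injective (pos w t) :=
  (arr (w.take t))⁻¹.injective

theorem exists_pos_eq (w : List ℕ) (t q : ℕ) : ∃ l, pos w t l = q :=
  (arr (w.take t))⁻¹.surjective q

theorem exists_step {w : List ℕ} {j v s t : ℕ} (hst : s ≤ t) (hs : cnt w j s < v)
    (ht : v ≤ cnt w j t) :
    ∃ r, s ≤ r ∧ r < t ∧ cnt w j r + 1 = v ∧ cnt w j (r + 1) = v ∧ ∃ h : r < w.length,
      w[r] = j := by
  induction t, hst using Nat.le_induction with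
  | base => omega
  | succ t hst ih =>
    by_cases h : v ≤ cnt w j t
    · obtain ⟨r, h1, h2, h3⟩ := ih h
      exact ⟨r, h1, by omega, h3⟩
    · rcases Nat.lt_or_ge t w.length with hl | hl
      · rw [cnt_succ hl] at ht
        split_ifs at ht with hw
        · refine ⟨t, hst, Nat.lt_succ_self t, by omega, ?_, hl, hw⟩
          rw [cnt_succ hl, if_pos hw]
          omega
        · omega
      · rw [cnt_succ_of_le hl] at ht
        omega

section Sweep

variable {m : ℕ} {w : List ℕ} (hw : IsSweep m w)
include hw

theorem IsSweep.pos_lt_succ {t a b : ℕ} (hab : a < b) (h : pos w t b < pos w t a) :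
    pos w (t + 1) b < pos w (t + 1) a := by
  rcases Nat.lt_or_ge t w.length with hl | hl
  · rw [pos_succ hl, pos_succ hl]
    refine swap_lt_swap h ?_
    rintro ⟨h1, h2⟩
    have := hw.ascent (w.take t) w[t] (w.drop (t + 1)) (by simp)
    rw [← h1, ← h2, arr_take_pos, arr_take_pos] at this
    omega
  · rwa [pos_succ_of_le hl, pos_succ_of_le hl]

theorem IsSweep.pos_lt_of_le {s t a b : ℕ} (hst : s ≤ t) (hab : a < b)
    (h : pos w s b < pos w s a) : pos w t b < pos w t a := by
  induction t, hst using Nat.le_induction with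
  | base => exact h
  | succ t _ ih => exact hw.pos_lt_succ hab ih

theorem IsSweep.lt_pos_of_le {s t a b : ℕ} (hst : s ≤ t) (hab : a < b)
    (h : pos w t a < pos w t b) : pos w s a < pos w s b := by
  by_contra hc
  have hne : pos w s b ≠ pos w s a := fun he => hab.ne' (pos_injective w s he)
  exact absurd (hw.pos_lt_of_le hst hab (lt_of_le_of_ne (not_lt.1 hc) hne)) h.le.not_gt

theorem IsSweep.le_pos_succ_iff {j t l : ℕ} (h : cnt w j (t + 1) = cnt w j t) :
    j ≤ pos w (t + 1) l ↔ j ≤ pos w t l := by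
  rcases Nat.lt_or_ge t w.length with hl | hl
  · rw [cnt_succ hl] at h
    have h1 := hw.letters w[t] (List.getElem_mem hl)
    have h2 : w[t] ≠ j := fun he => by simp [he] at h
    rw [pos_succ hl, Equiv.swap_apply_def]
    split_ifs <;> omega
  · rw [pos_succ_of_le hl]

theorem IsSweep.le_pos_iff_of_le {j s t l : ℕ} (hst : s ≤ t) (h : cnt w j s = cnt w j t) :
    j ≤ pos w s l ↔ j ≤ pos w t l := by
  induction t, hst using Nat.le_induction with
  | base => rfl
  | succ t hst ih =>
    have h1 := cnt_mono w j hst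
    have h2 := cnt_mono w j (show t ≤ t + 1 by omega)
    rw [ih (by omega), hw.le_pos_succ_iff (by omega)]

/-- The set of lines above a cell at level `j` is well defined. -/
theorem IsSweep.le_pos_iff {j s t l : ℕ} (h : cnt w j s = cnt w j t) :
    j ≤ pos w s l ↔ j ≤ pos w t l := by
  rcases le_total s t with hst | hst
  · exact hw.le_pos_iff_of_le hst h
  · exact (hw.le_pos_iff_of_le hst h.symm).symm

theorem IsSweep.pos_lt_of_cross {t j a b : ℕ} (ht : t < w.length) (hj : w[t] = j + 1)
    (ha : pos w t a = j) (hb : pos w t b = j + 1) :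
    a < b ∧ pos w (t + 1) a = j + 1 ∧ pos w (t + 1) b = j := by
  refine ⟨?_, ?_, ?_⟩
  · have := hw.ascent (w.take t) w[t] (w.drop (t + 1)) (by simp)
    have ha' := arr_take_pos w t a
    have hb' := arr_take_pos w t b
    rw [ha] at ha'
    rw [hb] at hb'
    rwa [hj, Nat.add_sub_cancel, ha', hb'] at this
  · rw [pos_succ ht, hj, ha, Nat.add_sub_cancel, Equiv.swap_apply_left]
  · rw [pos_succ ht, hj, hb, Nat.add_sub_cancel, Equiv.swap_apply_right]

end Sweep

/-- Line `l` carries a middle edge of the upper boundary of the cell `c` at level `j`: between the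
times `s` and `t`, where it crosses `p` and `r`, it runs along that cell. -/
structure IsMiddle (w : List ℕ) (j c v l s t p r : ℕ) : Prop where
  lt : s < t
  cell_left : cnt w j s = c
  cell_left' : cnt w j (s + 1) = c
  cell_right : cnt w j t = c
  cell_right' : cnt w j (t + 1) = c
  count_left : cnt w (j + 1) s + 1 = v
  count_left' : cnt w (j + 1) (s + 1) = v
  count_right : cnt w (j + 1) t = v
  count_right' : cnt w (j + 1) (t + 1) = v + 1
  lt_line : p < l
  line_lt : l < r
  pos_left : pos w s p = j ∧ pos w s l = j + 1
  pos_left' : pos w (s + 1) p = j + 1 ∧ pos w (s + 1) l = j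
  pos_right : pos w t l = j ∧ pos w t r = j + 1
  pos_right' : pos w (t + 1) l = j + 1 ∧ pos w (t + 1) r = j

/-- The gaps at level `j + 1` adjacent to the gap `c` at level `j`. -/
def succs (w : List ℕ) (j c : ℕ) : Finset ℕ :=
  ((Finset.range (w.length + 1)).filter fun t => cnt w j t = c).image (cnt w (j + 1))

theorem mem_succs {w : List ℕ} {j c v : ℕ} :
    v ∈ succs w j c ↔ ∃ t, t ≤ w.length ∧ cnt w j t = c ∧ cnt w (j + 1) t = v := by
  simp [succs, and_assoc]

/-- The elements of a finite set that are neither minimal nor maximal. -/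
def mids (S : Finset ℕ) : Finset ℕ := S.filter fun v => (∃ a ∈ S, a < v) ∧ ∃ b ∈ S, v < b

theorem IsSweep.exists_isMiddle {m : ℕ} {w : List ℕ} (hw : IsSweep m w) {j c v : ℕ}
    (hv : v ∈ mids (succs w j c)) : ∃ l s t p r, IsMiddle w j c v l s t p r := by
  simp only [mids, Finset.mem_filter] at hv
  obtain ⟨hv, ⟨a, ha, hav⟩, b, hb, hvb⟩ := hv
  obtain ⟨t₀, -, h01, h02⟩ := mem_succs.1 hv
  obtain ⟨ta, -, ha1, ha2⟩ := mem_succs.1 ha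
  obtain ⟨tb, -, hb1, hb2⟩ := mem_succs.1 hb
  have hm := cnt_mono w j
  have hat : ta ≤ t₀ := by
    by_contra hc
    have := cnt_mono w (j + 1) (not_le.1 hc).le
    omega
  have hbt : t₀ ≤ tb := by
    by_contra hc
    have := cnt_mono w (j + 1) (not_le.1 hc).le
    omega
  obtain ⟨s, s1, s2, s3, s4, s5, s6⟩ :=
    exists_step (w := w) (j := j + 1) (v := v) hat (by omega) h02.ge
  obtain ⟨t, t1, t2, t3, t4, t5, t6⟩ := exists_step (w := w) (j := j + 1) (v := v + 1) hbt (by omega) (by omega)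
  have hcell : ∀ x, ta ≤ x → x ≤ tb → cnt w j x = c := fun x h1 h2 => by
    have := hm h1
    have := hm h2
    omega
  have hs := hcell s s1 (by omega)
  have hs' := hcell (s + 1) (by omega) (by omega)
  have ht := hcell t (by omega) (by omega)
  have ht' := hcell (t + 1) (by omega) (by omega)
  have hc1 : cnt w (j + 1) t = v := by omega
  obtain ⟨p, hp⟩ := exists_pos_eq w s j
  obtain ⟨l, hl⟩ := exists_pos_eq w s (j + 1)
  obtain ⟨hpl, hp', hl'⟩ := hw.pos_lt_of_cross s5 s6 hp hl
  have h1 := (hw.le_pos_iff (l := l) (hs'.trans ht.symm)).1 hl'.ge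
  have h2 := mt (hw.le_pos_iff (l := l) (s4.trans hc1.symm)).2 (by omega)
  have hlt : pos w t l = j := by omega
  obtain ⟨r, hr⟩ := exists_pos_eq w t (j + 1)
  obtain ⟨hlr, hlt', hr'⟩ := hw.pos_lt_of_cross t5 t6 hlt hr
  exact ⟨l, s, t, p, r, by omega, hs, hs', ht, ht', s3, s4, hc1, t4, hpl, hlr, ⟨hp, hl⟩,
    ⟨hp', hl'⟩, ⟨hlt, hr⟩, ⟨hlt', hr'⟩⟩

theorem IsCut.exists_time {m : ℕ} {w : List ℕ} {g : ℕ → ℕ} (hg : IsCut m w g) {j : ℕ}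
    (hj : j < m) : ∃ t ≤ w.length, cnt w j t = g j ∧ cnt w (j + 1) t = g (j + 1) := by
  obtain ⟨x, hx, h1, h2⟩ := hg.adj j hj
  refine ⟨x.length, hx.length_le, ?_⟩
  rw [cnt, cnt, ← List.prefix_iff_eq_take.1 hx]
  exact ⟨h1, h2⟩

section Cut

variable {m : ℕ} {w : List ℕ} (hw : IsSweep m w) {g : ℕ → ℕ} (hg : IsCut m w g)
include hg

/-- A cutpath that is at time `t₀` when leaving level `j` and reaches a later time at level `k`
visits every intermediate time at some intermediate level. -/
theorem IsCut.exists_level_of_le {j k τ t₀ t : ℕ} (hjk : j < k) (hk : k ≤ m) (h₀ : t₀ ≤ τ)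
    (h₀' : cnt w (j + 1) t₀ = g (j + 1)) (ht : τ ≤ t) (ht' : cnt w k t = g k) :
    ∃ i, j < i ∧ i ≤ k ∧ cnt w i τ = g i := by
  have hbetween : ∀ i a b, a ≤ τ → τ ≤ b → cnt w i a = g i → cnt w i b = g i →
      cnt w i τ = g i := fun i a b ha hb h1 h2 => by
    have := cnt_mono w i ha
    have := cnt_mono w i hb
    omega
  induction k, hjk using Nat.le_induction generalizing t with
  | base => exact ⟨j + 1, by omega, le_rfl, hbetween _ _ _ h₀ ht h₀' ht'⟩
  | succ k hjk ih =>
    obtain ⟨T, -, h1, h2⟩ := hg.exists_time (show k < m by omega)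
    rcases le_total T τ with h | h
    · exact ⟨k + 1, by omega, le_rfl, hbetween _ _ _ h ht h2 ht'⟩
    · obtain ⟨i, hi, hik, hc⟩ := ih (by omega) h h1
      exact ⟨i, hi, by omega, hc⟩

theorem IsCut.exists_level_of_ge {j k τ t₀ t : ℕ} (hjk : j < k) (hk : k ≤ m) (h₀ : τ ≤ t₀)
    (h₀' : cnt w (j + 1) t₀ = g (j + 1)) (ht : t ≤ τ) (ht' : cnt w k t = g k) :
    ∃ i, j < i ∧ i ≤ k ∧ cnt w i τ = g i := by
  have hbetween : ∀ i a b, a ≤ τ → τ ≤ b → cnt w i a = g i → cnt w i b = g i →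
      cnt w i τ = g i := fun i a b ha hb h1 h2 => by
    have := cnt_mono w i ha
    have := cnt_mono w i hb
    omega
  induction k, hjk using Nat.le_induction generalizing t with
  | base => exact ⟨j + 1, by omega, le_rfl, hbetween _ _ _ ht h₀ ht' h₀'⟩
  | succ k hjk ih =>
    obtain ⟨T, -, h1, h2⟩ := hg.exists_time (show k < m by omega)
    rcases le_total τ T with h | h
    · exact ⟨k + 1, by omega, le_rfl, hbetween _ _ _ ht h ht' h2⟩
    · obtain ⟨i, hi, hik, hc⟩ := ih (by omega) h h1
      exact ⟨i, hi, by omega, hc⟩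

include hw

/-- A line above a cell of a cutpath is above all lower cells of the cutpath. -/
theorem IsCut.le_pos {j k s t l : ℕ} (hjk : j ≤ k) (hk : k ≤ m) (hs : cnt w j s = g j)
    (ht : cnt w k t = g k) (hl : k ≤ pos w t l) : j ≤ pos w s l := by
  induction k, hjk using Nat.le_induction generalizing t with
  | base => exact (hw.le_pos_iff (hs.trans ht.symm)).2 hl
  | succ k hjk ih =>
    obtain ⟨T, -, h1, h2⟩ := hg.exists_time (show k < m by omega)
    have := (hw.le_pos_iff (h2.trans ht.symm)).2 hl
    exact ih (by omega) h1 (by omega)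

/-- Along a cutpath, a line is a middle edge of at most one cell. -/
theorem IsCut.level_not_lt {j k u v l s t p r s' t' p' r' : ℕ} (hk : k < m)
    (h : IsMiddle w j (g j) u l s t p r) (h' : IsMiddle w k (g k) v l s' t' p' r') : ¬ j < k := by
  intro hjk
  obtain ⟨T, -, hT1, hT2⟩ := hg.exists_time (show j < m by omega)
  have above : ∀ {i τ}, i ≤ k → cnt w i τ = g i → i ≤ pos w τ l := fun hi hτ =>
    hg.le_pos hw hi hk.le hτ h'.cell_right h'.pos_right.1.ge
  rcases le_total T s with hTs | hTs
  · have hst : s + 1 ≤ t' := by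
      by_contra hc
      have hlt := hw.pos_lt_of_le (show t' + 1 ≤ s + 1 by omega) h'.line_lt
        (by rw [h'.pos_right'.1, h'.pos_right'.2]; omega)
      have := hg.le_pos hw hjk.le hk.le h.cell_left' h'.cell_right' h'.pos_right'.2.ge
      rw [h.pos_left'.2] at hlt
      omega
    obtain ⟨i, hji, hik, hi⟩ := hg.exists_level_of_le hjk hk.le (show T ≤ s + 1 by omega) hT2 hst
      h'.cell_right
    have := above hik hi
    rw [h.pos_left'.2] at this
    omega
  · have hts : s' ≤ t := by
      by_contra hc
      have hlt := hw.lt_pos_of_le (show t ≤ s' by omega) h'.lt_line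
        (by rw [h'.pos_left.1, h'.pos_left.2]; omega)
      have := hg.le_pos hw hjk.le hk.le h.cell_right h'.cell_left h'.pos_left.1.ge
      rw [h.pos_right.1] at hlt
      omega
    rcases le_total t T with htT | htT
    · obtain ⟨i, hji, hik, hi⟩ := hg.exists_level_of_ge hjk hk.le htT hT2 hts h'.cell_left
      have := above hik hi
      rw [h.pos_right.1] at this
      omega
    · have h1 := above hjk hT2
      rcases eq_or_lt_of_le hTs with rfl | hlt
      · have hst : s + 1 ≤ t' := by
          have := h'.lt
          by_contra hc
          have hlt := hw.pos_lt_of_le (show t' + 1 ≤ s + 1 by omega) h'.line_lt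
            (by rw [h'.pos_right'.1, h'.pos_right'.2]; omega)
          have := hg.le_pos hw hjk.le hk.le h.cell_left' h'.cell_right' h'.pos_right'.2.ge
          rw [h.pos_left'.2] at hlt
          omega
        obtain ⟨i, hji, hik, hi⟩ := hg.exists_level_of_le hjk hk.le (Nat.le_succ s) hT2 hst
          h'.cell_right
        have := above hik hi
        rw [h.pos_left'.2] at this
        omega
      · have h2 := cnt_mono w (j + 1) (show s + 1 ≤ T from hlt)
        have h3 := cnt_mono w (j + 1) htT
        rw [h.count_left'] at h2
        rw [h.count_right] at h3
        have := (hw.le_pos_iff (l := l) (show cnt w (j + 1) T = cnt w (j + 1) t by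
          rw [h.count_right]; omega)).1 h1
        rw [h.pos_right.1] at this
        omega

omit hg in
theorem IsSweep.gap_not_lt {j c u v l s t p r s' t' p' r' : ℕ}
    (h : IsMiddle w j c u l s t p r) (h' : IsMiddle w j c v l s' t' p' r') : ¬ u < v := by
  intro huv
  have hts : t + 1 ≤ s' + 1 := by
    by_contra hc
    have := cnt_mono w (j + 1) (show s' + 1 ≤ t by omega)
    rw [h'.count_left', h.count_right] at this
    omega
  have hlt := hw.pos_lt_of_le hts h.line_lt (by rw [h.pos_right'.1, h.pos_right'.2]; omega)
  have := (hw.le_pos_iff (h.cell_right'.trans h'.cell_left'.symm)).1 h.pos_right'.2.ge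
  rw [h'.pos_left'.2] at hlt
  omega

/-- The total number of middle edges seen along a cutpath is at most the number of lines. -/
theorem IsCut.sum_card_mids_le :
    ∑ j ∈ Finset.range m, (mids (succs w j (g j))).card ≤ m := by
  choose! f s t p r hf using
    fun (x : Σ _ : ℕ, ℕ) (hx : x.2 ∈ mids (succs w x.1 (g x.1))) => hw.exists_isMiddle hx
  rw [← Finset.card_sigma]
  conv_rhs => rw [← Finset.card_range m]
  refine Finset.card_le_card_of_injOn f ?_ ?_
  · rintro ⟨j, v⟩ hx
    have hx' := Finset.mem_sigma.1 (Finset.mem_coe.1 hx)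
    have h := (hf _ hx'.2).pos_right.1
    rw [pos, Equiv.Perm.inv_eq_iff_eq] at h
    rw [Finset.mem_coe, Finset.mem_range, h]
    exact arr_apply_lt (fun i hi => hw.letters i (List.mem_of_mem_take hi))
      (Finset.mem_range.1 hx'.1)
  · rintro ⟨j, u⟩ hx ⟨k, v⟩ hy hxy
    have hx' := Finset.mem_sigma.1 (Finset.mem_coe.1 hx)
    have hy' := Finset.mem_sigma.1 (Finset.mem_coe.1 hy)
    have h1 := hf _ hx'.2
    have h2 := hf _ hy'.2
    rw [← hxy] at h2
    have hjk : j = k := le_antisymm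
      (not_lt.1 (hg.level_not_lt hw (Finset.mem_range.1 hx'.1) h2 h1))
      (not_lt.1 (hg.level_not_lt hw (Finset.mem_range.1 hy'.1) h1 h2))
    subst hjk
    have huv : u = v := le_antisymm (not_lt.1 (hw.gap_not_lt h2 h1))
      (not_lt.1 (hw.gap_not_lt h1 h2))
    rw [huv]

end Cut

theorem sum_prod_le_one {S : ℕ → ℕ → Finset ℕ} {p : ℕ → ℕ → ℕ → ℝ} (hp : ∀ j c d, 0 ≤ p j c d)
    (hS : ∀ j c, ∑ d ∈ S j c, p j c d ≤ 1) (k : ℕ) (G : Finset (ℕ → ℕ)) (h0 : ∀ g ∈ G, g 0 = 0)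
    (hG : ∀ g ∈ G, ∀ j < k, g (j + 1) ∈ S j (g j)) (ht : ∀ g ∈ G, ∀ j, k < j → g j = 0) :
    ∑ g ∈ G, ∏ j ∈ Finset.range k, p j (g j) (g (j + 1)) ≤ 1 := by
  classical
  induction k generalizing G with
  | zero =>
    have hsub : G ⊆ {fun _ => 0} := fun g hg => Finset.mem_singleton.2 <| funext fun j => by
      rcases Nat.eq_zero_or_pos j with rfl | hj
      · exact h0 g hg
      · exact ht g hg j hj
    simpa using Finset.card_le_card hsub
  | succ k ih =>
    let φ : (ℕ → ℕ) → ℕ → ℕ := fun g => Function.update g (k + 1) 0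
    have hφ : ∀ g j, j ≤ k → φ g j = g j := fun g j hj =>
      Function.update_of_ne (by omega) _ _
    have hprod : ∀ g, ∏ j ∈ Finset.range k, p j (g j) (g (j + 1)) =
        ∏ j ∈ Finset.range k, p j (φ g j) (φ g (j + 1)) := fun g =>
      Finset.prod_congr rfl fun j hj => by
        have := Finset.mem_range.1 hj
        rw [hφ g j (by omega), hφ g (j + 1) (by omega)]
    rw [← Finset.sum_fiberwise_of_maps_to (g := φ) (t := G.image φ)
      fun g hg => Finset.mem_image_of_mem φ hg]
    refine le_trans (Finset.sum_le_sum (g := fun f =>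
      ∏ j ∈ Finset.range k, p j (f j) (f (j + 1))) fun f _ => ?_) (ih (G.image φ) ?_ ?_ ?_)
    · have hfib : ∀ g ∈ G.filter (φ · = f),
          ∏ j ∈ Finset.range (k + 1), p j (g j) (g (j + 1)) =
          (∏ j ∈ Finset.range k, p j (f j) (f (j + 1))) * p k (f k) (g (k + 1)) := by
        intro g hg
        obtain ⟨-, rfl⟩ := Finset.mem_filter.1 hg
        rw [Finset.prod_range_succ, hprod, hφ g k le_rfl]
      rw [Finset.sum_congr rfl hfib, ← Finset.mul_sum]
      refine mul_le_of_le_one_right (Finset.prod_nonneg fun j _ => hp _ _ _) ?_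
      have hinj : Set.InjOn (fun g : ℕ → ℕ => g (k + 1)) (G.filter (φ · = f) : Finset _) := by
        intro g hg g' hg' h
        have h1 := (Finset.mem_filter.1 (Finset.mem_coe.1 hg)).2
        have h2 := (Finset.mem_filter.1 (Finset.mem_coe.1 hg')).2
        funext j
        by_cases hj : j = k + 1
        · rw [hj]
          exact h
        · have := congrFun (h1.trans h2.symm) j
          simpa [φ, Function.update_of_ne hj] using this
      rw [← Finset.sum_image (f := p k (f k)) hinj]
      refine le_trans (Finset.sum_le_sum_of_subset_of_nonneg ?_ fun d _ _ => hp _ _ _) (hS k (f k))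
      intro d hd
      obtain ⟨g, hg, rfl⟩ := Finset.mem_image.1 hd
      obtain ⟨hgG, rfl⟩ := Finset.mem_filter.1 hg
      rw [hφ g k le_rfl]
      exact hG g hgG k (Nat.lt_succ_self k)
    · simp only [Finset.forall_mem_image]
      intro g hg
      rw [hφ g 0 (Nat.zero_le k), h0 g hg]
    · simp only [Finset.forall_mem_image]
      intro g hg j hj
      rw [hφ g j (by omega), hφ g (j + 1) (by omega)]
      exact hG g hg j (by omega)
    · simp only [Finset.forall_mem_image]
      intro g hg j hj
      by_cases hjk : j = k + 1
      · simp [φ, hjk]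
      · simpa [φ, Function.update_of_ne hjk] using ht g hg j (by omega)

/-- The weight of a step of a cutpath, choosing `d` among the continuations `S`. -/
noncomputable def weight (S : Finset ℕ) (d : ℕ) : ℝ :=
  (if S.card = 1 then 2.07 else 1) * if d ∈ mids S then 2.07⁻¹ else 1

theorem weight_nonneg (S : Finset ℕ) (d : ℕ) : 0 ≤ weight S d := by
  rw [weight]
  positivity

theorem card_sdiff_mids_le (S : Finset ℕ) : (S \ mids S).card ≤ 2 := by
  rcases S.eq_empty_or_nonempty with rfl | hS
  · simp
  refine le_trans (Finset.card_le_card (t := {S.min' hS, S.max' hS}) fun v hv => ?_)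
    Finset.card_le_two
  simp only [mids, Finset.mem_sdiff, Finset.mem_filter, not_and] at hv
  obtain ⟨hv, h⟩ := hv
  rw [Finset.mem_insert, Finset.mem_singleton]
  by_contra! hc
  exact h hv ⟨_, S.min'_mem hS, lt_of_le_of_ne (S.min'_le v hv) hc.1.symm⟩
    ⟨_, S.max'_mem hS, lt_of_le_of_ne (S.le_max' v hv) hc.2⟩

theorem two_add_le_mul_pow (p : ℕ) : 2 + (p : ℝ) * 2.07⁻¹ ≤ 2.07 * 1.2 ^ p := by
  rcases p with _ | p
  · norm_num
  induction p with
  | zero => norm_num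
  | succ p ih =>
    rw [pow_succ]
    push_cast at ih ⊢
    have : (0 : ℝ) ≤ p := p.cast_nonneg
    norm_num at ih ⊢
    linarith

theorem sum_weight_le (S : Finset ℕ) :
    ∑ d ∈ S, weight S d ≤ 2.07 * 1.2 ^ (mids S).card := by
  by_cases h1 : S.card = 1
  · obtain ⟨a, rfl⟩ := Finset.card_eq_one.1 h1
    have : mids {a} = ∅ := by
      ext v
      simp only [mids, Finset.mem_filter, Finset.mem_singleton, exists_eq_left,
        Finset.notMem_empty, iff_false]
      omega
    simp [weight, this]
  · have hsub : mids S ⊆ S := Finset.filter_subset _ _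
    have h2 : ∑ d ∈ S, weight S d = ((S \ mids S).card : ℝ) + (mids S).card * 2.07⁻¹ := by
      rw [← Finset.sum_sdiff hsub]
      congr 1
      · rw [Finset.sum_congr rfl (g := fun _ => (1 : ℝ)) fun d hd => by
          simp [weight, h1, (Finset.mem_sdiff.1 hd).2]]
        simp
      · rw [Finset.sum_congr rfl (g := fun _ => (2.07⁻¹ : ℝ)) fun d hd => by
          simp [weight, h1, hd]]
        simp
    have h3 : ((S \ mids S).card : ℝ) ≤ 2 := by exact_mod_cast card_sdiff_mids_le S
    rw [h2]
    exact le_trans (by gcongr) (two_add_le_mul_pow _)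

/-- The number of steps of the cutpath `g` at which it has only one continuation. -/
def numForced (m : ℕ) (w : List ℕ) (g : ℕ → ℕ) : ℕ :=
  ((Finset.range m).filter fun j => (succs w j (g j)).card = 1).card

/-- The number of steps at which the cutpath `g` crosses a middle edge. -/
def numMiddle (m : ℕ) (w : List ℕ) (g : ℕ → ℕ) : ℕ :=
  ((Finset.range m).filter fun j => g (j + 1) ∈ mids (succs w j (g j))).card

theorem one_le_prod_weight {m : ℕ} {w : List ℕ} {g : ℕ → ℕ}
    (h : numMiddle m w g ≤ numForced m w g) :
    1 ≤ ∏ j ∈ Finset.range m, weight (succs w j (g j)) (g (j + 1)) := by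
  simp only [weight, Finset.prod_mul_distrib, Finset.prod_ite, Finset.prod_const_one, mul_one,
    Finset.prod_const, inv_pow]
  rw [← div_eq_mul_inv, one_le_div (by positivity)]
  exact pow_le_pow_right₀ (by norm_num) h

theorem IsCut.mem_succs {m : ℕ} {w : List ℕ} {g : ℕ → ℕ} (hg : IsCut m w g) {j : ℕ}
    (hj : j < m) : g (j + 1) ∈ succs w j (g j) := by
  obtain ⟨t, h1, h2, h3⟩ := hg.exists_time hj
  exact PseudolineCount.mem_succs.2 ⟨t, h1, h2, h3⟩

theorem IsSweep.card_le_of_numMiddle_le {m : ℕ} {w : List ℕ} (hw : IsSweep m w)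
    (G : Finset (ℕ → ℕ)) (hG : ∀ g ∈ G, IsCut m w g)
    (hMF : ∀ g ∈ G, numMiddle m w g ≤ numForced m w g) : (G.card : ℝ) ≤ 2.484 ^ m := by
  let D : ℕ → ℕ → ℝ := fun j c => 2.07 * 1.2 ^ (mids (succs w j c)).card
  have hD : ∀ j c, 0 < D j c := fun j c => by positivity
  have key := sum_prod_le_one (S := succs w)
    (p := fun j c d => weight (succs w j c) d / D j c)
    (fun j c d => div_nonneg (weight_nonneg _ _) (hD j c).le)
    (fun j c => by
      rw [← Finset.sum_div, div_le_one (hD j c)]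
      exact sum_weight_le _)
    m G (fun g hg => (hG g hg).zero) (fun g hg j hj => (hG g hg).mem_succs hj)
    (fun g hg => (hG g hg).top)
  have hterm : ∀ g ∈ G, ((2.484 : ℝ) ^ m)⁻¹ ≤
      ∏ j ∈ Finset.range m, weight (succs w j (g j)) (g (j + 1)) / D j (g j) := by
    intro g hg
    have hDprod : ∏ j ∈ Finset.range m, D j (g j) ≤ 2.484 ^ m := by
      simp only [D, Finset.prod_mul_distrib, Finset.prod_const, Finset.card_range,
        Finset.prod_pow_eq_pow_sum]
      calc (2.07 : ℝ) ^ m * 1.2 ^ ∑ j ∈ Finset.range m, (mids (succs w j (g j))).card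
          ≤ 2.07 ^ m * 1.2 ^ m := by
            gcongr
            · norm_num
            · exact (hG g hg).sum_card_mids_le hw
        _ = 2.484 ^ m := by
            rw [← mul_pow]
            norm_num
    have hDpos : 0 < ∏ j ∈ Finset.range m, D j (g j) := Finset.prod_pos fun j _ => hD _ _
    rw [Finset.prod_div_distrib, inv_eq_one_div]
    exact div_le_div₀ (zero_le_one.trans (one_le_prod_weight (hMF g hg)))
      (one_le_prod_weight (hMF g hg)) hDpos hDprod
  have h := (Finset.card_nsmul_le_sum G _ _ hterm).trans key
  rwa [nsmul_eq_mul, ← div_eq_mul_inv, div_le_one (by positivity)] at h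

/-- The word of the arrangement reflected upside down. -/
def flipWord (m : ℕ) (w : List ℕ) : List ℕ := w.map (m - ·)

/-- The cutpath `g`, reflected upside down. -/
def flipCut (m : ℕ) (g : ℕ → ℕ) (j : ℕ) : ℕ := if j ≤ m then g (m - j) else 0

theorem flipWord_flipWord {m : ℕ} {w : List ℕ} (h : ∀ i ∈ w, i ≤ m) :
    flipWord m (flipWord m w) = w := by
  rw [flipWord, flipWord, List.map_map]
  exact (List.map_congr_left fun i hi => Nat.sub_sub_self (h i hi)).trans (List.map_id' w)

theorem count_flipWord {m : ℕ} {w : List ℕ} (h : ∀ i ∈ w, i ≤ m) {j : ℕ} (hj : j ≤ m) :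
    (flipWord m w).count j = w.count (m - j) := by
  induction w with
  | nil => rfl
  | cons i w ih =>
    have hi := h i List.mem_cons_self
    rw [flipWord, List.map_cons, List.count_cons, List.count_cons, ← flipWord,
      ih fun i hi => h i (List.mem_cons_of_mem _ hi)]
    simp only [beq_iff_eq]
    congr 1
    split_ifs <;> omega

theorem arr_flipWord {m : ℕ} {w : List ℕ} (h : ∀ i ∈ w, 1 ≤ i ∧ i < m) {q : ℕ} (hq : q < m) :
    arr (flipWord m w) q = m - 1 - arr w (m - 1 - q) := by
  induction w with
  | nil =>
    simp only [flipWord, List.map_nil, arr_nil, Equiv.Perm.one_apply]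
    omega
  | cons i w ih =>
    have h' := fun i hi => h i (List.mem_cons_of_mem _ hi)
    have hi := h i List.mem_cons_self
    have hlt := arr_apply_lt h' (show m - 1 - q < m by omega)
    rw [flipWord, List.map_cons, arr_cons, arr_cons, ← flipWord, Equiv.Perm.mul_apply,
      Equiv.Perm.mul_apply, ih h', Equiv.swap_apply_def, Equiv.swap_apply_def]
    split_ifs <;> omega

theorem IsSweep.flip {m : ℕ} {w : List ℕ} (hw : IsSweep m w) : IsSweep m (flipWord m w) where
  letters i hi := by
    obtain ⟨k, hk, rfl⟩ := List.mem_map.1 hi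
    have := hw.letters k hk
    omega
  ascent u i v h := by
    obtain ⟨u, w', rfl, rfl, h'⟩ := List.map_eq_append_iff.1 h
    obtain ⟨i, v, rfl, rfl, rfl⟩ := List.map_eq_cons_iff.1 h'
    have hu : ∀ k ∈ u, 1 ≤ k ∧ k < m := fun k hk => hw.letters k (by simp [hk])
    have hi := hw.letters i (by simp)
    have h1 := hw.ascent u i v rfl
    have h2 := arr_apply_lt hu hi.2
    change arr (flipWord m u) _ < arr (flipWord m u) _
    rw [arr_flipWord hu (by omega), arr_flipWord hu (by omega),
      show m - 1 - (m - i - 1) = i by omega, show m - 1 - (m - i) = i - 1 by omega]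
    omega
  final q hq := by
    rw [arr_flipWord hw.letters hq, hw.final _ (by omega)]
    omega

theorem IsCut.eq_zero {m : ℕ} {w : List ℕ} (hw : IsSweep m w) {g : ℕ → ℕ} (hg : IsCut m w g) :
    g m = 0 := by
  rcases m with _ | m
  · exact hg.zero
  · obtain ⟨x, hx, -, h⟩ := hg.adj m (Nat.lt_succ_self m)
    rw [← h, List.count_eq_zero]
    intro hm
    have := hw.letters _ (hx.subset hm)
    omega

theorem IsCut.flip {m : ℕ} {w : List ℕ} (hw : IsSweep m w) {g : ℕ → ℕ} (hg : IsCut m w g) :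
    IsCut m (flipWord m w) (flipCut m g) where
  zero := by simpa [flipCut] using hg.eq_zero hw
  adj j hj := by
    obtain ⟨x, hx, h1, h2⟩ := hg.adj (m - 1 - j) (by omega)
    have hle : ∀ i ∈ x, i ≤ m := fun i hi => (hw.letters i (hx.subset hi)).2.le
    rw [show m - 1 - j + 1 = m - j by omega] at h2
    refine ⟨flipWord m x, hx.map _, ?_, ?_⟩
    · rw [count_flipWord hle hj.le, flipCut, if_pos hj.le, h2]
    · rw [count_flipWord hle hj, flipCut, if_pos (by omega), show m - (j + 1) = m - 1 - j by omega,
        h1]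
  top j hj := if_neg (by omega)

theorem flipCut_flipCut {m : ℕ} {w : List ℕ} {g : ℕ → ℕ}
    (hg : IsCut m w g) : flipCut m (flipCut m g) = g := by
  funext j
  by_cases hj : j ≤ m
  · rw [flipCut, if_pos hj, flipCut, if_pos (Nat.sub_le m j), Nat.sub_sub_self hj]
  · rw [flipCut, if_neg hj, hg.top j (by omega)]

theorem cnt_flipWord {m : ℕ} {w : List ℕ} (h : ∀ i ∈ w, i ≤ m) {j : ℕ} (hj : j ≤ m) (t : ℕ) :
    cnt (flipWord m w) j t = cnt w (m - j) t := by
  rw [cnt, cnt, flipWord, ← List.map_take, ← flipWord,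
    count_flipWord (fun i hi => h i (List.mem_of_mem_take hi)) hj]

/-- A gap that is a middle edge of a cell sees no other cell on its lower side. -/
theorem cnt_eq_of_mem_mids {w : List ℕ} {j c t : ℕ}
    (h : cnt w (j + 1) t ∈ mids (succs w j c)) : cnt w j t = c := by
  simp only [mids, Finset.mem_filter] at h
  obtain ⟨-, ⟨a, ha, hav⟩, b, hb, hvb⟩ := h
  obtain ⟨ta, -, ha1, ha2⟩ := mem_succs.1 ha
  obtain ⟨tb, -, hb1, hb2⟩ := mem_succs.1 hb
  have h1 := cnt_mono w j (show ta ≤ t by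
    by_contra hc
    have := cnt_mono w (j + 1) (not_le.1 hc).le
    omega)
  have h2 := cnt_mono w j (show t ≤ tb by
    by_contra hc
    have := cnt_mono w (j + 1) (not_le.1 hc).le
    omega)
  omega

theorem IsCut.numMiddle_le {m : ℕ} {w : List ℕ} (hw : IsSweep m w) {g : ℕ → ℕ}
    (hg : IsCut m w g) : numMiddle m w g ≤ numForced m (flipWord m w) (flipCut m g) := by
  have hle : ∀ i ∈ w, i ≤ m := fun i hi => (hw.letters i hi).2.le
  refine Finset.card_le_card_of_injOn (fun j => m - 1 - j) ?_ ?_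
  · intro j hj
    obtain ⟨hj, hmid⟩ := Finset.mem_filter.1 (Finset.mem_coe.1 hj)
    rw [Finset.mem_range] at hj
    refine Finset.mem_coe.2 (Finset.mem_filter.2 ⟨Finset.mem_range.2 (show m - 1 - j < m by omega), ?_⟩)
    beta_reduce
    rw [Finset.card_eq_one]
    refine ⟨g j, Finset.eq_singleton_iff_unique_mem.2 ⟨?_, fun c hc => ?_⟩⟩
    · obtain ⟨t, h1, h2, h3⟩ := hg.exists_time hj
      refine PseudolineCount.mem_succs.2 ⟨t, by simpa [flipWord] using h1, ?_, ?_⟩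
      · rw [cnt_flipWord hle (by omega), flipCut, if_pos (by omega),
          show m - (m - 1 - j) = j + 1 by omega, h3]
      · rw [cnt_flipWord hle (by omega), show m - (m - 1 - j + 1) = j by omega, h2]
    · obtain ⟨t, -, h2, h3⟩ := PseudolineCount.mem_succs.1 hc
      rw [cnt_flipWord hle (by omega), flipCut, if_pos (by omega),
        show m - (m - 1 - j) = j + 1 by omega] at h2
      rw [cnt_flipWord hle (by omega), show m - (m - 1 - j + 1) = j by omega] at h3
      rw [← h2] at hmid
      rw [← h3, cnt_eq_of_mem_mids hmid]
  · intro j hj k hk h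
    have hj := Finset.mem_range.1 (Finset.mem_filter.1 (Finset.mem_coe.1 hj)).1
    have hk := Finset.mem_range.1 (Finset.mem_filter.1 (Finset.mem_coe.1 hk)).1
    simp only at h
    omega

theorem IsCut.numMiddle_flip_le {m : ℕ} {w : List ℕ} (hw : IsSweep m w) {g : ℕ → ℕ}
    (hg : IsCut m w g) : numMiddle m (flipWord m w) (flipCut m g) ≤ numForced m w g := by
  have h := (hg.flip hw).numMiddle_le hw.flip
  rwa [flipWord_flipWord fun i hi => (hw.letters i hi).2.le, flipCut_flipCut hg] at h

theorem IsSweep.card_cuts_le {m : ℕ} {w : List ℕ} (hw : IsSweep m w) (G : Finset (ℕ → ℕ))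
    (hG : ∀ g ∈ G, IsCut m w g) : (G.card : ℝ) ≤ 2 * 2.484 ^ m := by
  classical
  have h1 := hw.card_le_of_numMiddle_le (G.filter fun g => numMiddle m w g ≤ numForced m w g)
    (fun g hg => hG g (Finset.mem_filter.1 hg).1) fun g hg => (Finset.mem_filter.1 hg).2
  have h2 := hw.flip.card_le_of_numMiddle_le
    ((G.filter fun g => ¬ numMiddle m w g ≤ numForced m w g).image (flipCut m))
    (by
      simp only [Finset.forall_mem_image]
      exact fun g hg => (hG g (Finset.mem_filter.1 hg).1).flip hw)
    (by
      simp only [Finset.forall_mem_image]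
      intro g hg
      obtain ⟨hgG, hlt⟩ := Finset.mem_filter.1 hg
      have h3 := (hG g hgG).numMiddle_le hw
      have h4 := (hG g hgG).numMiddle_flip_le hw
      omega)
  rw [Finset.card_image_of_injOn fun g hg g' hg' h => by
    rw [← flipCut_flipCut (hG g (Finset.mem_filter.1 hg).1), h,
      flipCut_flipCut (hG g' (Finset.mem_filter.1 hg').1)]] at h2
  rw [← Finset.card_filter_add_card_filter_not (s := G)
    fun g => numMiddle m w g ≤ numForced m w g]
  push_cast
  linarith

theorem IsSweep.exists_finset_cuts {m : ℕ} {w : List ℕ} (hw : IsSweep m w) :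
    ∃ G : Finset (ℕ → ℕ), (∀ g, g ∈ G ↔ IsCut m w g) ∧ (G.card : ℝ) ≤ 2 * 2.484 ^ m := by
  have hfin : {g | IsCut m w g}.Finite := by
    by_contra hinf
    obtain ⟨G, hG, hcard⟩ := Set.Infinite.exists_subset_card_eq hinf (⌊(2 * 2.484 ^ m : ℝ)⌋₊ + 1)
    have h := Nat.le_floor (hw.card_cuts_le G fun g hg => hG hg)
    omega
  exact ⟨hfin.toFinset, fun g => by simp, hw.card_cuts_le _ fun g hg => by simpa using hg⟩

/-- Every arrangement of `m` pseudolines is represented by one of at most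
`∏ i < m, 2 * 2.484 ^ i` words. -/
theorem exists_representatives (m : ℕ) : ∃ F : Finset (List ℕ), (∀ u ∈ F, IsSweep m u) ∧
    (∀ w, IsSweep m w → ∃ u ∈ F, ∀ k, proj k u = proj k w) ∧
    (F.card : ℝ) ≤ ∏ i ∈ Finset.range m, 2 * (2.484 : ℝ) ^ i := by
  classical
  induction m with
  | zero =>
    have hnil : ∀ w, IsSweep 0 w → w = [] := fun w hw =>
      List.eq_nil_iff_forall_not_mem.2 fun i hi => by
        have := hw.letters i hi
        omega
    refine ⟨({[]} : Finset (List ℕ)).filter (IsSweep 0), by simp, fun w hw => ⟨w, ?_, fun _ => rfl⟩,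
      ?_⟩
    · rw [Finset.mem_filter, Finset.mem_singleton]
      exact ⟨hnil w hw, hw⟩
    · rw [Finset.prod_range_zero]
      exact_mod_cast Finset.card_filter_le ({[]} : Finset (List ℕ)) (IsSweep 0)
  | succ m ih =>
    obtain ⟨F, hF, hrep, hcard⟩ := ih
    choose! cuts hcuts hcuts_card using fun u (hu : IsSweep m u) => hu.exists_finset_cuts
    let P : (Σ _ : List ℕ, ℕ → ℕ) → List ℕ → Prop := fun x w =>
      IsSweep (m + 1) w ∧ (∀ k, proj k x.1 = proj k (del m w)) ∧ cutCount m w = x.2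
    let Q := (F.sigma cuts).filter fun x => ∃ w, P x w
    choose! f hf using fun x (hx : x ∈ Q) => (Finset.mem_filter.1 hx).2
    refine ⟨Q.image f, ?_, fun w hw => ?_, ?_⟩
    · simp only [Finset.forall_mem_image]
      exact fun x hx => (hf x hx).1
    · obtain ⟨u, hu, huw⟩ := hrep _ hw.crosses_and_del.2
      have hcut : IsCut m u (cutCount m w) := hw.isCut.of_proj_eq fun k => (huw k).symm
      have hx : (⟨u, cutCount m w⟩ : Σ _ : List ℕ, ℕ → ℕ) ∈ Q := Finset.mem_filter.2
        ⟨Finset.mem_sigma.2 ⟨hu, (hcuts u (hF u hu) _).2 hcut⟩, w, hw, huw, rfl⟩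
      obtain ⟨h1, h2, h3⟩ := hf _ hx
      exact ⟨_, Finset.mem_image_of_mem f hx, proj_eq_of_del_eq h1.crosses_and_del.1
        hw.crosses_and_del.1 (fun i hi => (h1.letters i hi).1) (fun i hi => (hw.letters i hi).1)
        (fun k => (h2 k).symm.trans (huw k)) h3⟩
    · calc ((Q.image f).card : ℝ) ≤ (F.sigma cuts).card := by
            exact_mod_cast Finset.card_image_le.trans (Finset.card_filter_le _ _)
        _ = ∑ u ∈ F, ((cuts u).card : ℝ) := by
            rw [Finset.card_sigma]
            push_cast
            rfl
        _ ≤ ∑ _u ∈ F, 2 * (2.484 : ℝ) ^ m := Finset.sum_le_sum fun u hu => hcuts_card u (hF u hu)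
        _ = F.card * (2 * 2.484 ^ m) := by rw [Finset.sum_const, nsmul_eq_mul]
        _ ≤ _ := by
            rw [Finset.prod_range_succ]
            gcongr

theorem prod_le_two_rpow {n : ℕ} (hn : 5000 ≤ n) :
    ∏ i ∈ Finset.range n, 2 * (2.484 : ℝ) ^ i ≤ 2 ^ ((0.6571 : ℝ) * (n : ℝ) ^ 2) := by
  have h : (2.484 : ℝ) ≤ 2 ^ (67 / 51 : ℝ) := by
    rw [← pow_le_pow_iff_left₀ (by norm_num) (by positivity) (show 51 ≠ 0 by norm_num),
      ← Real.rpow_mul_natCast two_pos.le, show (67 / 51 * (51 : ℕ) : ℝ) = (67 : ℕ) by norm_num,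
      Real.rpow_natCast]
    norm_num
  calc ∏ i ∈ Finset.range n, 2 * (2.484 : ℝ) ^ i
      = 2 ^ n * 2.484 ^ ∑ i ∈ Finset.range n, i := by
        rw [Finset.prod_mul_distrib, Finset.prod_const, Finset.card_range,
          Finset.prod_pow_eq_pow_sum]
    _ ≤ 2 ^ n * (2 ^ (67 / 51 : ℝ)) ^ ∑ i ∈ Finset.range n, i := by gcongr
    _ = 2 ^ (n + 67 / 51 * (∑ i ∈ Finset.range n, i : ℕ) : ℝ) := by
        rw [Real.rpow_add two_pos, Real.rpow_natCast, Real.rpow_mul_natCast two_pos.le]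
    _ ≤ _ := by
        refine Real.rpow_le_rpow_of_exponent_le one_le_two ?_
        have hsum : ((∑ i ∈ Finset.range n, i : ℕ) : ℝ) = n * (n - 1) / 2 := by
          rw [Finset.sum_range_id, Nat.cast_div (Nat.even_mul_pred_self n).two_dvd two_ne_zero,
            Nat.cast_mul, Nat.cast_pred (by omega)]
          norm_num
        have hn' : (5000 : ℝ) ≤ n := by exact_mod_cast hn
        rw [hsum]
        nlinarith

end PseudolineCount

/-- Felsner–Valtr upper bound: for sufficiently large `n`,
`cₙ ≤ 2^(0.6571 n²)`. -/
theorem felsner_valtr_upper_bound :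
    ∃ N : ℕ, ∀ n : ℕ, N ≤ n →
      (numCommClasses n : ℝ) ≤ (2 : ℝ) ^ ((0.6571 : ℝ) * (n : ℝ) ^ 2) := by
  refine ⟨5000, fun n hn => ?_⟩
  obtain ⟨F, -, hrep, hcard⟩ := PseudolineCount.exists_representatives n
  have h : (numCommClasses n : ℝ) ≤ F.card := by
    exact_mod_cast PseudolineCount.numCommClasses_le F hrep
  exact h.trans (hcard.trans (PseudolineCount.prod_le_two_rpow hn))
end
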